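/- For c > 0, the KL divergence of the probability distribution on [0,1] with density u ↦ c e^{cu}/(e^c − 1) from the uniform distribution on [0,1] equals ((c−1)e^c + 1)/(e^c − 1) − log((e^c − 1)/c). -/

import Mathlib

open Real intervalIntegral

/-- For `c > 0`, the KL divergence of the distribution on `[0,1]` with density
`u ↦ c e^{cu}/(e^c − 1)` from the uniform distribution equals
`((c−1)e^c + 1)/(e^c − 1) − log((e^c − 1)/c)`. -/
theorem klDiv_exp_tilt (c : ℝ) (hc : 0 < c) :
    (∫ u in (0:ℝ)..1,
        (c * Real.exp (c * u) / (Real.exp c - 1)) *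
          Real.log (c * Real.exp (c * u) / (Real.exp c - 1))) =
      ((c - 1) * Real.exp c + 1) / (Real.exp c - 1)
        - Real.log ((Real.exp c - 1) / c) := by
  have hE : 0 < Real.exp c - 1 := by
    have := Real.add_one_lt_exp hc.ne'
    linarith
  have hlog : ∀ u : ℝ, Real.log (c * Real.exp (c * u) / (Real.exp c - 1)) =
      c * u - Real.log ((Real.exp c - 1) / c) := by
    intro u
    rw [Real.log_div (by positivity) hE.ne', Real.log_mul hc.ne' (Real.exp_pos _).ne',
      Real.log_exp, Real.log_div hE.ne' hc.ne']
    ring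
  simp only [hlog]
  generalize Real.log ((Real.exp c - 1) / c) = L
  have hder : ∀ u ∈ Set.uIcc (0:ℝ) 1,
      HasDerivAt (fun u : ℝ => Real.exp (c * u) * (c * u - 1 - L) / (Real.exp c - 1))
        ((c * Real.exp (c * u) / (Real.exp c - 1)) * (c * u - L)) u := by
    intro u _
    have h1 : HasDerivAt (fun u : ℝ => c * u) c u := by
      simpa using (hasDerivAt_id u).const_mul c
    have h2 := (h1.exp.mul ((h1.sub_const 1).sub_const L)).div_const (Real.exp c - 1)
    refine HasDerivAt.congr_deriv h2 ?_
    field_simp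
    ring
  rw [integral_eq_sub_of_hasDerivAt hder (Continuous.intervalIntegrable (by fun_prop) _ _)]
  have := hE.ne'
  simp only [mul_one, mul_zero, Real.exp_zero]
  field_simp
  ring
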